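/- arXiv:math/0206263 — 2 statements merged into one kernel-verified Lean document; each statement's English description precedes it below -/
import Mathlib

section
/- For every n ∈ ℤ one has Ô_n = {(w,c) : w a word of length m, c ∈ ℤ, N(w) ≡ n − c (mod m)}. Consequently Ô_n = Ô_{n'} if and only if n ≡ n' (mod m), and the set of all pairs (w,c) is the disjoint union of Ô_0, Ô_1, …, Ô_{m−1}. -/
open Finset Polynomial

namespace GreensteinPaths

noncomputable section

attribute [local instance] Classical.propDecidable

variable {ℓ m : ℕ}

/-- The Kashiwara function `R^i_p(w)` (positions are 0-based: index `p` is
the mathematical position `p+1`, i.e. the `(p+1)`-th tensor factor counted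
from the right). -/
def Rf (i : ZMod (ℓ + 1)) (w : Fin m → ZMod (ℓ + 1)) (p : Fin m) : ℤ :=
    (if i = w p then 1 else 0)
  + ∑ s ∈ univ.filter (fun s : Fin m => p < s),
      ((if i = w s then 1 else 0) - (if i = w s + 1 then 1 else 0))

/-- `ε_i(w) = max_p R^i_p(w)` (the maximum is nonnegative for `m ≥ 1`,
so we may record it as a natural number). -/
def eps (i : ZMod (ℓ + 1)) (w : Fin m → ZMod (ℓ + 1)) : ℕ :=
  univ.sup fun p => (Rf i w p).toNat

/-- `φ_i(w) = ε_i(w) + Σ_s (δ_{i,w_s+1} − δ_{i,w_s})`. -/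
def phiW (i : ZMod (ℓ + 1)) (w : Fin m → ZMod (ℓ + 1)) : ℤ :=
  (eps i w : ℤ)
    + ∑ s : Fin m, ((if i = w s + 1 then 1 else 0) - (if i = w s then 1 else 0))

/-- The Kashiwara operator `e_i`, as a partial map: take the largest `p`
with `R^i_p(w) = ε_i(w)`; if `w_p = i`, replace it by `i - 1`, otherwise
the result is undefined. -/
def eOp (i : ZMod (ℓ + 1)) (w : Fin m → ZMod (ℓ + 1)) :
    Option (Fin m → ZMod (ℓ + 1)) :=
  WithBot.recBotCoe none
    (fun p => if w p = i then some (Function.update w p (i - 1)) else none)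
    ((univ.filter fun p => Rf i w p = (eps i w : ℤ)).max)

/-- The Kashiwara operator `f_i`, as a partial map: take the smallest `p`
with `R^i_p(w) = ε_i(w)`; if `w_p = i - 1`, replace it by `i`, otherwise
the result is undefined. -/
def fOp (i : ZMod (ℓ + 1)) (w : Fin m → ZMod (ℓ + 1)) :
    Option (Fin m → ZMod (ℓ + 1)) :=
  WithTop.recTopCoe none
    (fun p => if w p = i - 1 then some (Function.update w p i) else none)
    ((univ.filter fun p => Rf i w p = (eps i w : ℤ)).min)

/-- The descent set of a word, 0-based: `r ∈ desc w` corresponds to the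
mathematical descent `r+1` (i.e. `w_{r+1} > w_{r+2}` in 1-based notation),
letters being compared as integers in `{0,…,ℓ}`. -/
def desc (w : Fin m → ZMod (ℓ + 1)) : Finset (Fin m) :=
  univ.filter fun r : Fin m =>
    ∃ h : (r : ℕ) + 1 < m, (w ⟨(r : ℕ) + 1, h⟩).val < (w r).val

/-- `N(w) = Σ_{r=1}^{k} r (n_r − n_{r−1})` where `0 = n_0 < n_1 < ⋯ < n_{k−1} < n_k = m`
and `n_1 < ⋯ < n_{k−1}` are the descents: equivalently the mathematical
position `p` (`1 ≤ p ≤ m`) contributes `1` plus the number of descents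
strictly below `p`. -/
def Nfun (w : Fin m → ZMod (ℓ + 1)) : ℕ :=
  ∑ p : Fin m, (1 + ((desc w).filter fun r => r < p).card)

/-- The major index: the sum of the descents (which are `r+1` for the
0-based `r ∈ desc w`). -/
def MajFun (w : Fin m → ZMod (ℓ + 1)) : ℕ :=
  ∑ r ∈ desc w, ((r : ℕ) + 1)

/-- Content of a word: `content w j` is the number of positions carrying the letter `j`. -/
def content (w : Fin m → ZMod (ℓ + 1)) (j : ZMod (ℓ + 1)) : ℕ :=
  (univ.filter fun p => w p = j).card

/-- The affine operator `ê_i` on pairs `(w, c)`. -/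
def eHat (i : ZMod (ℓ + 1)) (x : (Fin m → ZMod (ℓ + 1)) × ℤ) :
    Option ((Fin m → ZMod (ℓ + 1)) × ℤ) :=
  (eOp i x.1).map fun w' => (w', x.2 + if i = 0 then 1 else 0)

/-- The affine operator `f̂_i` on pairs `(w, c)`. -/
def fHat (i : ZMod (ℓ + 1)) (x : (Fin m → ZMod (ℓ + 1)) × ℤ) :
    Option ((Fin m → ZMod (ℓ + 1)) × ℤ) :=
  (fOp i x.1).map fun w' => (w', x.2 - if i = 0 then 1 else 0)

/-- One application of some `ê_i` or `f̂_i`. -/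
def hatStep (x y : (Fin m → ZMod (ℓ + 1)) × ℤ) : Prop :=
  ∃ i, eHat i x = some y ∨ fHat i x = some y

/-- `Ô_n`: all pairs obtainable from `((0,…,0), n)` by finitely many
applications of the operators `ê_i`, `f̂_i`. -/
def Ohat (n : ℤ) : Set ((Fin m → ZMod (ℓ + 1)) × ℤ) :=
  {x | Relation.ReflTransGen hatStep ((fun _ => 0), n) x}

/-- Successive application of a partial operator along a list of indices
(the head of the list is applied first); the result is defined only if
every intermediate application is defined. -/
def applyList
    (op : ZMod (ℓ + 1) → (Fin m → ZMod (ℓ + 1)) → Option (Fin m → ZMod (ℓ + 1))) :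
    List (ZMod (ℓ + 1)) → (Fin m → ZMod (ℓ + 1)) → Option (Fin m → ZMod (ℓ + 1))
  | [], w => some w
  | i :: is, w => (op i w).bind (applyList op is)

/-- `n`-fold application of `e_i`. -/
def eIter (i : ZMod (ℓ + 1)) : ℕ → (Fin m → ZMod (ℓ + 1)) → Option (Fin m → ZMod (ℓ + 1))
  | 0, w => some w
  | n + 1, w => (eOp i w).bind (eIter i n)

/-- `φ_n(d) = φ(d)·μ(d/g)/φ(d/g)`, `g = gcd(d,|n|)`. -/
def phiInt (n : ℤ) (d : ℕ) : ℚ :=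
  (Nat.totient d : ℚ) * (ArithmeticFunction.moebius (d / Nat.gcd d n.natAbs) : ℚ)
    / (Nat.totient (d / Nat.gcd d n.natAbs) : ℚ)

/-- The multinomial coefficient `(m/d)! / ((k_0/d)! ⋯ (k_ℓ/d)!)`, with the
convention that it is `0` unless all its entries are (nonnegative) integers. -/
def multinomialQ {ι : Type} [Fintype ι] (M : ℕ) (k : ι → ℕ) (d : ℕ) : ℚ :=
  if d ∣ M ∧ ∀ j, d ∣ k j then
    ((M / d).factorial : ℚ) / ∏ j, ((k j / d).factorial : ℚ)
  else 0

/-- `C(k_0,…,k_ℓ; n) = (1/m) Σ_{d ∣ m} φ_n(d) · multinomial(m/d; k_j/d)`. -/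
def Cfun {ι : Type} [Fintype ι] (M : ℕ) (k : ι → ℕ) (n : ℤ) : ℚ :=
  (1 / (M : ℚ)) * ∑ d ∈ M.divisors, phiInt n d * multinomialQ M k d

/-- `C̃(k_0,…,k_ℓ; d) = (d/m) Σ_{d d' ∣ m} μ(d') · multinomial(m/(dd'); k_j/(dd'))`. -/
def Ctil {ι : Type} [Fintype ι] (M : ℕ) (k : ι → ℕ) (d : ℕ) : ℚ :=
  ((d : ℚ) / (M : ℚ)) *
    ∑ d' ∈ M.divisors.filter (fun d' => d * d' ∣ M),
      (ArithmeticFunction.moebius d' : ℚ) * multinomialQ M k (d * d')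

/-- `[n]_q = 1 + q + ⋯ + q^{n−1}` in `ℤ[q]`. -/
def qNat (n : ℕ) : Polynomial ℤ := ∑ i ∈ Finset.range n, X ^ i

/-- `[n]_q! = [n]_q [n−1]_q ⋯ [1]_q`. -/
def qFactorial (n : ℕ) : Polynomial ℤ := ∏ i ∈ Finset.range n, qNat (i + 1)

/-- The Gaussian multinomial `[n; k_1,…,k_r]_q = [n]_q!/([k_1]_q! ⋯ [k_r]_q!)`
(an exact division of polynomials, performed here as division by a monic
polynomial), with the convention that it is `0` if `n ≠ k_1 + ⋯ + k_r`. -/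
def qMultinomial {ι : Type} [Fintype ι] (n : ℕ) (k : ι → ℕ) : Polynomial ℤ :=
  if ∑ j, k j = n then qFactorial n /ₘ ∏ j, qFactorial (k j) else 0

end

section

attribute [local instance] Classical.propDecidable

variable {ℓ m : ℕ}

theorem Rf_of_succ_eq (i : ZMod (ℓ + 1)) (w : Fin m → ZMod (ℓ + 1)) {p q : Fin m}
    (h : (p : ℕ) + 1 = q) :
    Rf i w p = Rf i w q + (if i = w p then 1 else 0) - (if i = w q + 1 then 1 else 0) := by
  have hs : univ.filter (fun s : Fin m => p < s)
      = insert q (univ.filter (fun s : Fin m => q < s)) := by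
    ext s
    simp only [mem_filter, mem_univ, true_and, mem_insert, Fin.lt_def, Fin.ext_iff]
    omega
  unfold Rf
  rw [hs, sum_insert (by simp)]
  ring

theorem Rf_of_last (i : ZMod (ℓ + 1)) (w : Fin m → ZMod (ℓ + 1)) {p : Fin m}
    (h : (p : ℕ) + 1 = m) : Rf i w p = if i = w p then 1 else 0 := by
  have hs : univ.filter (fun s : Fin m => p < s) = ∅ := by
    ext s
    simp only [mem_filter, mem_univ, true_and, Fin.lt_def, notMem_empty, iff_false]
    omega
  unfold Rf
  rw [hs, sum_empty, add_zero]

theorem Rf_le_eps (i : ZMod (ℓ + 1)) (w : Fin m → ZMod (ℓ + 1)) (p : Fin m) :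
    Rf i w p ≤ eps i w :=
  (Int.self_le_toNat _).trans <| by
    exact_mod_cast le_sup (f := fun p => (Rf i w p).toNat) (mem_univ p)

theorem exists_Rf_eq_eps (hm : 1 ≤ m) (i : ZMod (ℓ + 1)) (w : Fin m → ZMod (ℓ + 1)) :
    ∃ p, Rf i w p = eps i w := by
  have hlast := Rf_of_last i w (p := ⟨m - 1, by omega⟩) (by simp; omega)
  have hle := Rf_le_eps i w ⟨m - 1, by omega⟩
  have hnonneg : 0 ≤ Rf i w ⟨m - 1, by omega⟩ := by rw [hlast]; split_ifs <;> simp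
  obtain ⟨p, -, hp⟩ := exists_mem_eq_sup (univ : Finset (Fin m)) ⟨⟨m - 1, by omega⟩, mem_univ _⟩
    fun p => (Rf i w p).toNat
  change eps i w = _ at hp
  by_cases h : 0 ≤ Rf i w p
  · exact ⟨p, by omega⟩
  · exact ⟨⟨m - 1, by omega⟩, by omega⟩

theorem eps_eq_of_forall_le {i : ZMod (ℓ + 1)} {w : Fin m → ZMod (ℓ + 1)} {p : Fin m} {c : ℤ}
    (hp : Rf i w p = c) (h : ∀ s, Rf i w s ≤ c) : (eps i w : ℤ) = c := by
  obtain ⟨q, hq⟩ := exists_Rf_eq_eps (by have := p.isLt; omega) i w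
  have := h q
  have := Rf_le_eps i w p
  omega

theorem eOp_eq_some_iff {i : ZMod (ℓ + 1)} {w w' : Fin m → ZMod (ℓ + 1)} :
    eOp i w = some w' ↔ ∃ p, Rf i w p = eps i w ∧ (∀ s, p < s → Rf i w s < eps i w) ∧
      w p = i ∧ Function.update w p (i - 1) = w' := by
  have hlt : ∀ s, Rf i w s < eps i w ↔ Rf i w s ≠ eps i w := fun s =>
    (Rf_le_eps i w s).lt_iff_ne
  unfold eOp
  constructor
  · intro h
    rcases hmax : (univ.filter fun p => Rf i w p = (eps i w : ℤ)).max with _ | p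
    · rw [hmax] at h
      exact absurd h (by simp [WithBot.recBotCoe])
    · rw [hmax] at h
      have h' : (if w p = i then some (Function.update w p (i - 1)) else none) = some w' := h
      split_ifs at h' with hw
      refine ⟨p, (mem_filter.1 (mem_of_max hmax)).2, fun s hs => (hlt s).2 fun he => ?_, hw,
        Option.some.inj h'⟩
      exact absurd (le_max_of_eq (mem_filter.2 ⟨mem_univ s, he⟩) hmax) (not_le.2 hs)
  · rintro ⟨p, hp, hs, hw, rfl⟩
    have hmax : (univ.filter fun p => Rf i w p = (eps i w : ℤ)).max = (p : WithBot (Fin m)) := by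
      refine le_antisymm (Finset.max_le fun s hs' => ?_)
        (le_max (mem_filter.2 ⟨mem_univ _, hp⟩))
      by_contra hc
      have hps : p < s := by simpa using hc
      exact (hs s hps).ne (mem_filter.1 hs').2
    rw [hmax, WithBot.recBotCoe_coe, if_pos hw]

theorem fOp_eq_some_iff {i : ZMod (ℓ + 1)} {w w' : Fin m → ZMod (ℓ + 1)} :
    fOp i w = some w' ↔ ∃ p, Rf i w p = eps i w ∧ (∀ s, s < p → Rf i w s < eps i w) ∧
      w p = i - 1 ∧ Function.update w p i = w' := by
  have hlt : ∀ s, Rf i w s < eps i w ↔ Rf i w s ≠ eps i w := fun s =>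
    (Rf_le_eps i w s).lt_iff_ne
  unfold fOp
  constructor
  · intro h
    rcases hmin : (univ.filter fun p => Rf i w p = (eps i w : ℤ)).min with _ | p
    · rw [hmin] at h
      exact absurd h (by simp [WithTop.recTopCoe])
    · rw [hmin] at h
      have h' : (if w p = i - 1 then some (Function.update w p i) else none) = some w' := h
      split_ifs at h' with hw
      refine ⟨p, (mem_filter.1 (mem_of_min hmin)).2, fun s hs => (hlt s).2 fun he => ?_, hw,
        Option.some.inj h'⟩
      exact absurd (min_le_of_eq (mem_filter.2 ⟨mem_univ s, he⟩) hmin) (not_le.2 hs)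
  · rintro ⟨p, hp, hs, hw, rfl⟩
    have hmin : (univ.filter fun p => Rf i w p = (eps i w : ℤ)).min = (p : WithTop (Fin m)) := by
      refine le_antisymm (min_le (mem_filter.2 ⟨mem_univ _, hp⟩))
        (Finset.le_min fun s hs' => ?_)
      by_contra hc
      have hps : s < p := by simpa using hc
      exact (hs s hps).ne (mem_filter.1 hs').2
    rw [hmin, WithTop.recTopCoe_coe, if_pos hw]

theorem add_one_ne_self (hℓ : 1 ≤ ℓ) (i : ZMod (ℓ + 1)) : i + 1 ≠ i := by
  have : Fact (1 < ℓ + 1) := ⟨by omega⟩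
  simp

theorem sub_one_ne_self (hℓ : 1 ≤ ℓ) (i : ZMod (ℓ + 1)) : i - 1 ≠ i := by
  have : Fact (1 < ℓ + 1) := ⟨by omega⟩
  simp

/-- `w'` arises from `w` by lowering the letter `i` at position `p` to `i - 1`, where the left
neighbour of `p` is not `i` and the right neighbour is not `i - 1`. -/
structure LowersAt (i : ZMod (ℓ + 1)) (p : Fin m) (w w' : Fin m → ZMod (ℓ + 1)) : Prop where
  apply_eq : w p = i
  update_eq : Function.update w p (i - 1) = w'
  pred_ne : ∀ q : Fin m, (q : ℕ) + 1 = p → w q ≠ i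
  succ_ne : ∀ q : Fin m, (p : ℕ) + 1 = q → w q ≠ i - 1

theorem exists_lowersAt_of_eOp (hℓ : 1 ≤ ℓ) {i : ZMod (ℓ + 1)} {w w' : Fin m → ZMod (ℓ + 1)}
    (h : eOp i w = some w') : ∃ p, LowersAt i p w w' := by
  obtain ⟨p, hp, hs, hw, hu⟩ := eOp_eq_some_iff.1 h
  refine ⟨p, hw, hu, fun q hq hwq => ?_, fun q hq hwq => ?_⟩
  · have h1 := Rf_of_succ_eq i w hq
    have h2 := Rf_le_eps i w q
    rw [hw, hwq, if_pos rfl, if_neg (add_one_ne_self hℓ i).symm] at h1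
    omega
  · have h1 := Rf_of_succ_eq i w hq
    have h2 := hs q (by rw [Fin.lt_def]; omega)
    rw [hw, hwq, if_pos rfl, if_pos (by ring)] at h1
    omega

theorem exists_lowersAt_of_fOp (hℓ : 1 ≤ ℓ) {i : ZMod (ℓ + 1)} {w w' : Fin m → ZMod (ℓ + 1)}
    (h : fOp i w = some w') : ∃ p, LowersAt i p w' w := by
  obtain ⟨p, hp, hs, hw, rfl⟩ := fOp_eq_some_iff.1 h
  refine ⟨p, by simp, by simp [← hw], fun q hq hwq => ?_, fun q hq hwq => ?_⟩
  · rw [Function.update_of_ne (by rintro rfl; omega)] at hwq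
    have h1 := Rf_of_succ_eq i w hq
    have h2 := hs q (by rw [Fin.lt_def]; omega)
    rw [hw, hwq, if_pos rfl, if_pos (by ring)] at h1
    omega
  · rw [Function.update_of_ne (by rintro rfl; omega)] at hwq
    have h1 := Rf_of_succ_eq i w hq
    have h2 := Rf_le_eps i w q
    rw [hw, hwq, if_neg (sub_one_ne_self hℓ i).symm, if_pos (by ring)] at h1
    omega

theorem exists_eOp_eq_some (hm : 1 ≤ m) {i : ZMod (ℓ + 1)} {w : Fin m → ZMod (ℓ + 1)}
    {q : Fin m} (hq : (q : ℕ) + 1 = m) (hw : w q = i) : ∃ w', eOp i w = some w' := by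
  have hpos : 1 ≤ (eps i w : ℤ) := by
    have h1 := Rf_le_eps i w q
    rwa [Rf_of_last i w hq, if_pos hw.symm] at h1
  obtain ⟨p₀, hp₀⟩ := exists_Rf_eq_eps hm i w
  obtain ⟨p, hp, hmax⟩ := (univ.filter fun p => Rf i w p = (eps i w : ℤ)).exists_max_image id
    ⟨p₀, mem_filter.2 ⟨mem_univ _, hp₀⟩⟩
  have hp := (mem_filter.1 hp).2
  have hlt : ∀ s, p < s → Rf i w s < eps i w := fun s hs =>
    lt_of_le_of_ne (Rf_le_eps i w s) fun he =>
      absurd (hmax s (mem_filter.2 ⟨mem_univ _, he⟩)) (not_le.2 hs)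
  refine ⟨_, eOp_eq_some_iff.2 ⟨p, hp, hlt, ?_, rfl⟩⟩
  by_contra hne
  have hne' : i ≠ w p := fun h => hne h.symm
  by_cases hlast : (p : ℕ) + 1 = m
  · rw [Rf_of_last i w hlast, if_neg hne'] at hp
    omega
  · have h1 := Rf_of_succ_eq i w (p := p) (q := ⟨p + 1, by omega⟩) rfl
    have h2 := hlt ⟨p + 1, by omega⟩ (by simp [Fin.lt_def])
    rw [if_neg hne'] at h1
    split_ifs at h1 <;> omega

theorem Rf_update_of_lt (i a : ZMod (ℓ + 1)) (w : Fin m → ZMod (ℓ + 1)) {p s : Fin m}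
    (h : p < s) : Rf i (Function.update w p a) s = Rf i w s := by
  unfold Rf
  rw [Function.update_of_ne h.ne']
  congr 1
  refine sum_congr rfl fun t ht => ?_
  rw [Function.update_of_ne (h.trans (mem_filter.1 ht).2).ne']

theorem Rf_update_self (hℓ : 1 ≤ ℓ) {i : ZMod (ℓ + 1)} {w : Fin m → ZMod (ℓ + 1)} {p : Fin m}
    (h : w p = i) : Rf i (Function.update w p (i - 1)) p = Rf i w p - 1 := by
  unfold Rf
  rw [Function.update_self, if_neg (sub_one_ne_self hℓ i).symm, if_pos h.symm]
  rw [sum_congr rfl fun t ht => by rw [Function.update_of_ne (mem_filter.1 ht).2.ne']]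
  ring

theorem Rf_update_of_gt (hℓ : 1 ≤ ℓ) {i : ZMod (ℓ + 1)} {w : Fin m → ZMod (ℓ + 1)}
    {p s : Fin m} (h : w p = i) (hs : s < p) :
    Rf i (Function.update w p (i - 1)) s = Rf i w s - 2 := by
  have hp : p ∈ univ.filter (fun t : Fin m => s < t) := mem_filter.2 ⟨mem_univ _, hs⟩
  unfold Rf
  rw [Function.update_of_ne hs.ne, ← add_sum_erase _ _ hp, ← add_sum_erase _ _ hp,
    Function.update_self, if_neg (sub_one_ne_self hℓ i).symm, if_pos h.symm,
    if_pos (show i = i - 1 + 1 by ring), h, if_neg (add_one_ne_self hℓ i).symm]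
  rw [sum_congr rfl fun t ht => by rw [Function.update_of_ne (mem_erase.1 ht).1]]
  ring

theorem fOp_eq_some_of_eOp (hℓ : 1 ≤ ℓ) {i : ZMod (ℓ + 1)} {w w' : Fin m → ZMod (ℓ + 1)}
    (h : eOp i w = some w') : fOp i w' = some w := by
  obtain ⟨p, hp, hs, hw, rfl⟩ := eOp_eq_some_iff.1 h
  have hself := Rf_update_self hℓ hw
  have heps : (eps i (Function.update w p (i - 1)) : ℤ) = eps i w - 1 := by
    refine eps_eq_of_forall_le (p := p) (by omega) fun s => ?_
    have hle := Rf_le_eps i w s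
    rcases lt_trichotomy s p with hsp | rfl | hsp
    · have := Rf_update_of_gt hℓ hw hsp
      omega
    · omega
    · have := Rf_update_of_lt i (i - 1) w hsp
      have := hs s hsp
      omega
  refine fOp_eq_some_iff.2 ⟨p, by omega, fun s hsp => ?_, by simp, by simp [← hw]⟩
  have := Rf_update_of_gt hℓ hw hsp
  have hle := Rf_le_eps i w s
  omega

theorem Nfun_eq_sum (w : Fin m → ZMod (ℓ + 1)) :
    (Nfun w : ℤ) = m + ∑ r : Fin m, (if r ∈ desc w then 1 else 0) * ((m : ℤ) - 1 - r) := by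
  have hcard : ∀ r : Fin m,
      ((univ.filter fun p : Fin m => r < p).card : ℤ) = (m : ℤ) - 1 - r := by
    intro r
    have : (univ.filter fun p : Fin m => r < p) = Ioi r := by ext; simp
    rw [this, Fin.card_Ioi]
    omega
  unfold Nfun
  push_cast
  rw [sum_add_distrib]
  congr 1
  · simp
  · simp_rw [← hcard, card_filter, Nat.cast_sum, mul_sum]
    rw [sum_comm]
    rw [← sum_filter_add_sum_filter_not univ (fun r => r ∈ desc w)]
    simp +contextual [sum_filter]

theorem val_sub_one (i : ZMod (ℓ + 1)) : (i - 1).val = if i = 0 then ℓ else i.val - 1 := by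
  split_ifs with h
  · rw [h, zero_sub, ZMod.val_neg_one]
  · have hpos : i.val ≠ 0 := (ZMod.val_eq_zero i).not.2 h
    have hlt := ZMod.val_lt i
    have : Fact (1 < ℓ + 1) := ⟨by omega⟩
    rw [ZMod.val_sub (by rw [ZMod.val_one]; omega), ZMod.val_one]

theorem LowersAt.ite_desc_sub {i : ZMod (ℓ + 1)} {p : Fin m}
    {w w' : Fin m → ZMod (ℓ + 1)} (h : LowersAt i p w w') {r : Fin m} (hr : (r : ℕ) + 1 < m) :
    ((if r ∈ desc w' then 1 else 0) - (if r ∈ desc w then 1 else 0) : ℤ)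
      = if i = 0 then (if r = p then 1 else 0) - (if (r : ℕ) + 1 = p then 1 else 0) else 0 := by
  obtain ⟨hw, rfl, hpred, hsucc⟩ := h
  have hdesc : ∀ v : Fin m → ZMod (ℓ + 1), r ∈ desc v ↔ (v ⟨r + 1, hr⟩).val < (v r).val :=
    fun v => by simp [desc, hr]
  have hsub := val_sub_one i
  have hi := (ZMod.val_eq_zero i).not
  simp only [hdesc]
  by_cases hrp : r = p
  · subst hrp
    have hne := (ZMod.val_injective _).ne (hsucc ⟨r + 1, hr⟩ rfl)
    have hlt := ZMod.val_lt (w ⟨r + 1, hr⟩)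
    rw [Function.update_self, Function.update_of_ne (by simp [Fin.ext_iff]), hw]
    by_cases h0 : i = 0
    · subst h0
      simp only [if_true, ZMod.val_zero] at hsub ⊢
      rw [if_pos (by omega), if_neg (by omega), if_neg (by omega)]
    · rw [if_neg h0] at hsub ⊢
      have := hi.2 h0
      split_ifs <;> omega
  · by_cases hsp : (r : ℕ) + 1 = p
    · obtain rfl : p = ⟨r + 1, hr⟩ := Fin.ext hsp.symm
      have hne := (ZMod.val_injective _).ne (hpred r rfl)
      have hlt := ZMod.val_lt (w r)
      rw [Function.update_self, Function.update_of_ne hrp, hw]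
      by_cases h0 : i = 0
      · subst h0
        simp only [if_true, ZMod.val_zero] at hsub hne ⊢
        rw [if_neg (by omega), if_pos (by omega), if_neg hrp]
      · rw [if_neg h0] at hsub ⊢
        have := hi.2 h0
        split_ifs <;> omega
    · rw [Function.update_of_ne hrp, Function.update_of_ne (by simpa [Fin.ext_iff] using hsp)]
      simp [hrp, hsp]

theorem LowersAt.Nfun_modEq {i : ZMod (ℓ + 1)} {p : Fin m}
    {w w' : Fin m → ZMod (ℓ + 1)} (h : LowersAt i p w w') :
    (Nfun w' : ℤ) + (if i = 0 then 1 else 0) ≡ Nfun w [ZMOD m] := by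
  have hterm : ∀ r : Fin m,
      ((if r ∈ desc w' then 1 else 0) - (if r ∈ desc w then 1 else 0) : ℤ) * ((m : ℤ) - 1 - r)
      = (if i = 0 then 1 else 0) * ((if r = p then ((m : ℤ) - 1 - r) else 0)
        - (if (r : ℕ) + 1 = p then ((m : ℤ) - 1 - r) else 0)) := by
    intro r
    by_cases hr : (r : ℕ) + 1 < m
    · rw [h.ite_desc_sub hr]
      split_ifs <;> simp
    · have : (m : ℤ) - 1 - r = 0 := by omega
      simp [this]
  have hsum : ∑ r : Fin m, (if (r : ℕ) + 1 = p then ((m : ℤ) - 1 - r) else 0)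
      = if (p : ℕ) = 0 then 0 else (m : ℤ) - p := by
    split_ifs with hp
    · exact sum_eq_zero fun r _ => if_neg (by omega)
    · rw [sum_eq_single (⟨p - 1, by omega⟩ : Fin m)]
      · rw [if_pos (by simp; omega)]
        push_cast [Nat.cast_sub (Nat.one_le_iff_ne_zero.2 hp)]
        ring
      · intro r _ hr
        rw [if_neg]
        intro h'
        exact hr (Fin.ext (by simp; omega))
      · simp
  have hdiff : (Nfun w' : ℤ) - Nfun w = (if i = 0 then 1 else 0) *
      (((m : ℤ) - 1 - p) - if (p : ℕ) = 0 then 0 else (m : ℤ) - p) := by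
    rw [Nfun_eq_sum, Nfun_eq_sum, add_sub_add_left_eq_sub, ← sum_sub_distrib]
    simp_rw [← sub_mul, hterm]
    rw [← mul_sum, sum_sub_distrib, hsum]
    simp
  rw [Int.modEq_iff_dvd]
  by_cases hp : (p : ℕ) = 0
  · refine ⟨-(if i = 0 then 1 else 0), ?_⟩
    rw [if_pos hp, hp] at hdiff
    push_cast at hdiff
    linear_combination -hdiff
  · refine ⟨0, ?_⟩
    rw [if_neg hp] at hdiff
    linear_combination -hdiff

theorem hatStep.modEq (hℓ : 1 ≤ ℓ) {x y : (Fin m → ZMod (ℓ + 1)) × ℤ} (h : hatStep x y) :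
    (Nfun x.1 : ℤ) + x.2 ≡ Nfun y.1 + y.2 [ZMOD m] := by
  obtain ⟨i, h | h⟩ := h
  · obtain ⟨w', hw', rfl⟩ := Option.map_eq_some_iff.1 h
    obtain ⟨p, hp⟩ := exists_lowersAt_of_eOp hℓ hw'
    have := hp.Nfun_modEq.add_right x.2
    convert this.symm using 1
    ring
  · obtain ⟨w', hw', rfl⟩ := Option.map_eq_some_iff.1 h
    obtain ⟨p, hp⟩ := exists_lowersAt_of_fOp hℓ hw'
    have := hp.Nfun_modEq.add_right (x.2 - if i = 0 then 1 else 0)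
    convert this using 1
    ring

theorem modEq_of_mem_Ohat (hℓ : 1 ≤ ℓ) {n : ℤ} {x : (Fin m → ZMod (ℓ + 1)) × ℤ}
    (h : x ∈ Ohat n) : (Nfun x.1 : ℤ) + x.2 ≡ n [ZMOD m] := by
  induction (h : Relation.ReflTransGen hatStep ((fun _ => 0), n) x) with
  | refl =>
    have : Nfun (fun _ : Fin m => (0 : ZMod (ℓ + 1))) = m := by simp [Nfun, desc]
    simp [this, Int.ModEq]
  | tail _ hstep ih => exact (hstep.modEq hℓ).symm.trans ih

/-- One application of some `ê_i`. -/
def eHatStep (x y : (Fin m → ZMod (ℓ + 1)) × ℤ) : Prop := ∃ i, eHat i x = some y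

theorem eHatStep.swap_hatStep (hℓ : 1 ≤ ℓ) {x y : (Fin m → ZMod (ℓ + 1)) × ℤ}
    (h : eHatStep x y) : hatStep y x := by
  obtain ⟨i, h⟩ := h
  obtain ⟨w', hw', rfl⟩ := Option.map_eq_some_iff.1 h
  refine ⟨i, Or.inr ?_⟩
  simp [fHat, fOp_eq_some_of_eOp hℓ hw']

theorem reflTransGen_hatStep_of_eHatStep {x y : (Fin m → ZMod (ℓ + 1)) × ℤ}
    (h : Relation.ReflTransGen eHatStep x y) : Relation.ReflTransGen hatStep x y :=
  Relation.ReflTransGen.mono (fun _ _ ⟨i, h⟩ => ⟨i, Or.inl h⟩) _ _ h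

theorem reflTransGen_hatStep_swap (hℓ : 1 ≤ ℓ) {x y : (Fin m → ZMod (ℓ + 1)) × ℤ}
    (h : Relation.ReflTransGen eHatStep x y) : Relation.ReflTransGen hatStep y x :=
  Relation.ReflTransGen.mono (r := Function.swap eHatStep)
    (fun _ _ h => eHatStep.swap_hatStep hℓ h) _ _ (Relation.ReflTransGen.swap _ _ h)

theorem LowersAt.content_add_one (hℓ : 1 ≤ ℓ) {i : ZMod (ℓ + 1)} {p : Fin m}
    {w w' : Fin m → ZMod (ℓ + 1)} (h : LowersAt i p w w') :
    content w' i + 1 = content w i := by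
  have hs : univ.filter (fun q => w' q = i) = (univ.filter fun q => w q = i).erase p := by
    ext q
    obtain ⟨hw, rfl, -, -⟩ := h
    by_cases hq : q = p
    · subst hq
      simp [sub_one_ne_self hℓ i]
    · simp [hq]
  unfold content
  rw [hs]
  exact card_erase_add_one (by simp [h.apply_eq])

theorem exists_lower_suffix_aux (hℓ : 1 ≤ ℓ) (hm : 1 ≤ m) (i : ZMod (ℓ + 1)) (q : ℕ)
    (k : ℕ) (w : Fin m → ZMod (ℓ + 1)) (c : ℤ) (hk : content w i = k)
    (hletter : ∀ p : Fin m, q ≤ p → w p = i ∨ w p = i - 1)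
    (hmono : ∀ p s : Fin m, q ≤ p → (p : ℕ) + 1 = s → w p = i → w s = i) :
    ∃ w' : Fin m → ZMod (ℓ + 1),
      Relation.ReflTransGen eHatStep (w, c)
        (w', c + if i = 0 then (content w i : ℤ) - content w' i else 0) ∧
      (∀ p : Fin m, q ≤ p → w' p = i - 1) ∧ ∀ p, w p ≠ i → w' p = w p := by
  induction k generalizing w c with
  | zero =>
    refine ⟨w, by simp [Relation.ReflTransGen.refl], fun p hp => ?_, fun _ _ => rfl⟩
    refine (hletter p hp).resolve_left fun h => ?_
    have : p ∈ univ.filter fun p => w p = i := mem_filter.2 ⟨mem_univ _, h⟩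
    rw [content, card_eq_zero] at hk
    simp [hk] at this
  | succ k ih =>
    by_cases hlast : w ⟨m - 1, by omega⟩ = i
    · obtain ⟨w₁, hw₁⟩ := exists_eOp_eq_some hm (by simp; omega) hlast
      obtain ⟨p, hp⟩ := exists_lowersAt_of_eOp hℓ hw₁
      have hcont := hp.content_add_one hℓ
      obtain ⟨hwp, rfl, hpred, hsucc⟩ := hp
      obtain ⟨w', hreach, hsuf, hkeep⟩ := ih (Function.update w p (i - 1))
        (c + if i = 0 then 1 else 0) (by omega)
        (fun s hs => by
          by_cases hsp : s = p
          · subst hsp; simp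
          · rw [Function.update_of_ne hsp]; exact hletter s hs)
        (fun s t hs hst hws => by
          have hsp : s ≠ p := by
            rintro rfl
            exact sub_one_ne_self hℓ i (by simpa using hws)
          rw [Function.update_of_ne hsp] at hws
          have htp : t ≠ p := by
            rintro rfl
            exact hpred s hst hws
          rw [Function.update_of_ne htp]
          exact hmono s t hs hst hws)
      refine ⟨w', Relation.ReflTransGen.head ⟨i, ?_⟩ (?_ : Relation.ReflTransGen eHatStep
        (Function.update w p (i - 1), c + if i = 0 then 1 else 0) _), hsuf, fun s hs => ?_⟩
      · simp [eHat, hw₁]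
      · convert hreach using 2
        rw [← hcont]
        split_ifs <;> push_cast <;> ring
      · have hsp : s ≠ p := by rintro rfl; exact hs hwp
        have := hkeep s (by rwa [Function.update_of_ne hsp])
        rwa [Function.update_of_ne hsp] at this
    · refine ⟨w, by simp [Relation.ReflTransGen.refl], fun p hp => ?_, fun _ _ => rfl⟩
      refine (hletter p hp).resolve_left fun h => hlast ?_
      have hall : ∀ d : ℕ, ∀ hd : (p : ℕ) + d < m, w ⟨p + d, hd⟩ = i := by
        intro d
        induction d with
        | zero => intro _; exact h
        | succ d ihd =>
          intro hd
          exact hmono ⟨p + d, by omega⟩ _ (by simp; omega) (by simp; omega) (ihd (by omega))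
      have := hall (m - 1 - p) (by omega)
      convert this using 3
      omega

/-- A constant suffix of letters `i` can be lowered to a constant suffix of letters `i - 1`
by operators `ê_i`, without changing letters other than `i`. -/
theorem exists_lower_suffix (hℓ : 1 ≤ ℓ) (hm : 1 ≤ m) (i : ZMod (ℓ + 1)) {q : ℕ}
    (w : Fin m → ZMod (ℓ + 1)) (c : ℤ) (hw : ∀ p : Fin m, q ≤ p → w p = i) :
    ∃ w' : Fin m → ZMod (ℓ + 1),
      Relation.ReflTransGen eHatStep (w, c)
        (w', c + if i = 0 then (content w i : ℤ) - content w' i else 0) ∧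
      (∀ p : Fin m, q ≤ p → w' p = i - 1) ∧ ∀ p, w p ≠ i → w' p = w p :=
  exists_lower_suffix_aux hℓ hm i q _ w c rfl (fun p hp => Or.inl (hw p hp))
    fun p s hp hs _ => hw s (by omega)

theorem reflTransGen_const_sub_one (hℓ : 1 ≤ ℓ) (hm : 1 ≤ m) (i : ZMod (ℓ + 1)) (c : ℤ) :
    Relation.ReflTransGen eHatStep ((fun _ : Fin m => i), c)
      ((fun _ => i - 1), c + if i = 0 then (m : ℤ) else 0) := by
  obtain ⟨w', hreach, hsuf, -⟩ :=
    exists_lower_suffix hℓ hm i (q := 0) (fun _ => i) c fun _ _ => rfl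
  obtain rfl : w' = fun _ => i - 1 := funext fun p => hsuf p (Nat.zero_le _)
  simpa [content, sub_one_ne_self hℓ i] using hreach

theorem reflTransGen_const_zero (hℓ : 1 ≤ ℓ) (hm : 1 ≤ m) (c : ℤ) (k : ℕ) (hk : k ≤ ℓ) :
    Relation.ReflTransGen eHatStep ((fun _ : Fin m => (k : ZMod (ℓ + 1))), c)
      ((fun _ => 0), c) := by
  induction k with
  | zero => simp [Relation.ReflTransGen.refl]
  | succ k ih =>
    have hne : ((k + 1 : ℕ) : ZMod (ℓ + 1)) ≠ 0 := by
      rw [Ne, ZMod.natCast_eq_zero_iff]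
      exact fun h => absurd (Nat.le_of_dvd (by omega) h) (by omega)
    have := reflTransGen_const_sub_one (m := m) hℓ hm ((k + 1 : ℕ) : ZMod (ℓ + 1)) c
    rw [if_neg hne, add_zero] at this
    refine this.trans ?_
    convert ih (by omega) using 3
    push_cast
    ring

theorem reflTransGen_zero_add (hℓ : 1 ≤ ℓ) (hm : 1 ≤ m) (c : ℤ) :
    Relation.ReflTransGen eHatStep ((fun _ : Fin m => (0 : ZMod (ℓ + 1))), c)
      ((fun _ => 0), c + m) := by
  have h1 := reflTransGen_const_sub_one (ℓ := ℓ) hℓ hm 0 c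
  rw [if_pos rfl] at h1
  refine h1.trans ?_
  convert reflTransGen_const_zero hℓ hm (c + m) ℓ le_rfl using 3
  have : ((ℓ + 1 : ℕ) : ZMod (ℓ + 1)) = 0 := ZMod.natCast_self _
  push_cast at this
  linear_combination -this

theorem zero_hatStep_zero_add_mul (hℓ : 1 ≤ ℓ) (hm : 1 ≤ m) (c t : ℤ) :
    Relation.ReflTransGen hatStep ((fun _ : Fin m => (0 : ZMod (ℓ + 1))), c)
      ((fun _ => 0), c + m * t) := by
  induction t using Int.induction_on with
  | zero => simp [Relation.ReflTransGen.refl]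
  | succ t ih =>
    refine ih.trans ?_
    convert reflTransGen_hatStep_of_eHatStep (reflTransGen_zero_add hℓ hm _) using 2
    ring
  | pred t ih =>
    refine ih.trans ?_
    convert reflTransGen_hatStep_swap hℓ (reflTransGen_zero_add (ℓ := ℓ) hℓ hm
      (c + m * (-t - 1))) using 2
    ring

theorem exists_match_suffix (hℓ : 1 ≤ ℓ) (hm : 1 ≤ m) {q : ℕ} (hq : q + 1 < m)
    (j : ZMod (ℓ + 1)) (d : ℕ) (w : Fin m → ZMod (ℓ + 1)) (c : ℤ)
    (hj : w ⟨q, by omega⟩ = j) (hw : ∀ p : Fin m, q + 1 ≤ p → w p = j + d) (hd : d ≤ ℓ) :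
    ∃ (w' : Fin m → ZMod (ℓ + 1)) (c' : ℤ), Relation.ReflTransGen eHatStep (w, c) (w', c') ∧
      ∀ p : Fin m, q ≤ p → w' p = j := by
  induction d generalizing w c with
  | zero =>
    refine ⟨w, c, .refl, fun p hp => ?_⟩
    rcases hp.eq_or_lt with h | h
    · subst h; exact hj
    · simpa using hw p h
  | succ d ih =>
    obtain ⟨w₁, hreach, hsuf, hkeep⟩ := exists_lower_suffix hℓ hm _ w c hw
    have hne : j ≠ j + (d + 1 : ℕ) := by
      rw [Ne, left_eq_add, ZMod.natCast_eq_zero_iff]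
      exact fun h => absurd (Nat.le_of_dvd (by omega) h) (by omega)
    obtain ⟨w', c', hreach', h'⟩ := ih w₁ _ ((hkeep _ (hj ▸ hne)).trans hj)
      (fun p hp => by rw [hsuf p hp]; push_cast; ring) (by omega)
    exact ⟨w', c', hreach.trans hreach', h'⟩

theorem exists_const_suffix (hℓ : 1 ≤ ℓ) (hm : 1 ≤ m) (w : Fin m → ZMod (ℓ + 1)) (c : ℤ)
    (k : ℕ) (hk : k < m) :
    ∃ (w' : Fin m → ZMod (ℓ + 1)) (c' : ℤ) (i : ZMod (ℓ + 1)),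
      Relation.ReflTransGen eHatStep (w, c) (w', c') ∧
      ∀ p : Fin m, m - 1 - k ≤ p → w' p = i := by
  induction k with
  | zero =>
    refine ⟨w, c, w ⟨m - 1, by omega⟩, .refl, fun p hp => congrArg w (Fin.ext ?_)⟩
    simp
    omega
  | succ k ih =>
    obtain ⟨w₁, c₁, i, hreach, hsuf⟩ := ih (by omega)
    obtain ⟨w', c', hreach', h'⟩ := exists_match_suffix hℓ hm (q := m - 1 - (k + 1)) (by omega)
      (w₁ ⟨m - 1 - (k + 1), by omega⟩) (i - w₁ ⟨m - 1 - (k + 1), by omega⟩).val w₁ c₁ rfl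
      (fun p hp => by rw [hsuf p (by omega)]; simp) (Nat.lt_succ_iff.1 (ZMod.val_lt _))
    exact ⟨w', c', _, hreach.trans hreach', h'⟩

theorem exists_reflTransGen_zero (hℓ : 1 ≤ ℓ) (hm : 1 ≤ m) (w : Fin m → ZMod (ℓ + 1)) (c : ℤ) :
    ∃ c' : ℤ, Relation.ReflTransGen eHatStep (w, c) ((fun _ => 0), c') := by
  obtain ⟨w', c', i, hreach, hsuf⟩ := exists_const_suffix hℓ hm w c (m - 1) (by omega)
  obtain rfl : w' = fun _ => i := funext fun p => hsuf p (by omega)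
  have := reflTransGen_const_zero (m := m) hℓ hm c' i.val (Nat.lt_succ_iff.1 (ZMod.val_lt _))
  rw [ZMod.natCast_zmod_val] at this
  exact ⟨c', hreach.trans this⟩

theorem mem_Ohat_iff (hℓ : 1 ≤ ℓ) (hm : 1 ≤ m) {n : ℤ} {x : (Fin m → ZMod (ℓ + 1)) × ℤ} :
    x ∈ Ohat n ↔ (Nfun x.1 : ℤ) ≡ n - x.2 [ZMOD m] := by
  have key : (Nfun x.1 : ℤ) ≡ n - x.2 [ZMOD m] ↔ (Nfun x.1 : ℤ) + x.2 ≡ n [ZMOD m] := by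
    rw [Int.modEq_iff_dvd, Int.modEq_iff_dvd]
    ring_nf
  rw [key]
  refine ⟨modEq_of_mem_Ohat hℓ, fun h => ?_⟩
  obtain ⟨c', hc'⟩ := exists_reflTransGen_zero hℓ hm x.1 x.2
  have hback := reflTransGen_hatStep_swap hℓ hc'
  have hmod := h.symm.trans (modEq_of_mem_Ohat hℓ (n := c') hback)
  obtain ⟨t, ht⟩ := (Int.modEq_iff_dvd.1 hmod)
  have h1 := zero_hatStep_zero_add_mul (ℓ := ℓ) hℓ hm n t
  rw [← ht, add_sub_cancel] at h1
  exact h1.trans hback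

end

/-- `Ô_n` consists exactly of the pairs `(w,c)` with
`N(w) ≡ n − c (mod m)`; consequently `Ô_n = Ô_{n'}` iff `n ≡ n' (mod m)`,
and every pair lies in exactly one of `Ô_0, …, Ô_{m−1}`. -/
theorem stmt_1 (ℓ m : ℕ) (hℓ : 1 ≤ ℓ) (hm : 1 ≤ m) :
    (∀ n : ℤ, Ohat (ℓ := ℓ) (m := m) n =
      {x : (Fin m → ZMod (ℓ + 1)) × ℤ |
        (Nfun x.1 : ℤ) ≡ n - x.2 [ZMOD (m : ℤ)]}) ∧
    (∀ n n' : ℤ,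
      Ohat (ℓ := ℓ) (m := m) n = Ohat n' ↔ n ≡ n' [ZMOD (m : ℤ)]) ∧
    (∀ x : (Fin m → ZMod (ℓ + 1)) × ℤ,
      ∃! n : ℕ, n < m ∧ x ∈ Ohat (n : ℤ)) := by
  have hzero : (Nfun (fun _ : Fin m => (0 : ZMod (ℓ + 1))) : ℤ) ≡ 0 [ZMOD m] := by
    simp [Nfun, desc, Int.ModEq]
  refine ⟨fun n => Set.ext fun x => mem_Ohat_iff hℓ hm, fun n n' => ⟨fun h => ?_, fun h => ?_⟩,
    fun x => ?_⟩
  · have hmem : ((fun _ => 0, n) : (Fin m → ZMod (ℓ + 1)) × ℤ) ∈ Ohat n' :=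
      h ▸ (Relation.ReflTransGen.refl : Relation.ReflTransGen hatStep _ _)
    have := modEq_of_mem_Ohat hℓ hmem
    simpa using (hzero.add_right n).symm.trans this
  · ext x
    rw [mem_Ohat_iff hℓ hm, mem_Ohat_iff hℓ hm]
    exact ⟨fun hx => hx.trans (h.sub_right _), fun hx => hx.trans (h.symm.sub_right _)⟩
  · have hm0 : (m : ℤ) ≠ 0 := by omega
    have hpos : 0 < (m : ℤ) := by omega
    have hmem : ∀ n : ℤ, x ∈ Ohat n ↔ (Nfun x.1 : ℤ) + x.2 ≡ n [ZMOD m] := fun n => by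
      rw [mem_Ohat_iff hℓ hm, Int.modEq_iff_dvd, Int.modEq_iff_dvd]
      ring_nf
    generalize (Nfun x.1 : ℤ) + x.2 = a at hmem
    have hnonneg := Int.emod_nonneg a hm0
    have hlt := Int.emod_lt_of_pos a hpos
    refine ⟨(a % m).toNat, ⟨by omega, (hmem _).2 ?_⟩, ?_⟩
    · rw [Int.toNat_of_nonneg hnonneg]
      exact (Int.mod_modEq _ _).symm
    · rintro n ⟨hn, hx⟩
      have : a % m = n % m := (hmem _).1 hx
      rw [Int.emod_eq_of_lt (a := (n : ℤ)) (by omega) (by omega)] at this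
      omega

end GreensteinPaths
end

section
/- Let (k_0,…,k_ℓ) be nonnegative integers with k_0 + ⋯ + k_ℓ = m and let n ∈ {0,…,m−1}. Then the number of words w of length m with content (k_0,…,k_ℓ) and N(w) ≡ n (mod m) equals (1/m)·Σ_{d ∣ gcd(k_0,…,k_ℓ)} φ_{−n}(d)·(m/d)!/((k_0/d)!⋯(k_ℓ/d)!). -/
open Finset Polynomial

namespace GreensteinPaths

noncomputable section

attribute [local instance] Classical.propDecidable

variable {ℓ m : ℕ}

end

section QAnalogues
variable {R : Type*} [CommRing R]

/-- The `q`-number `[n]_q` evaluated at an element `q` of a commutative ring. -/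
def qInt (q : R) (n : ℕ) : R := ∑ i ∈ range n, q ^ i

/-- The `q`-factorial `[n]_q!` evaluated at an element `q` of a commutative ring. -/
def qFact (q : R) (n : ℕ) : R := ∏ i ∈ range n, qInt q (i + 1)

@[simp] lemma qInt_zero (q : R) : qInt q 0 = 0 := by simp [qInt]

lemma qInt_one_left (n : ℕ) : qInt (1 : R) n = n := by simp [qInt]

lemma qInt_add (q : R) (a b : ℕ) : qInt q (a + b) = qInt q a + q ^ a * qInt q b := by
  simp [qInt, sum_range_add, pow_add, mul_sum]

lemma qInt_mul (q : R) (d b : ℕ) : qInt q (d * b) = qInt q d * qInt (q ^ d) b := by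
  induction b with
  | zero => simp
  | succ b ih =>
    rw [mul_add, mul_one, qInt_add, ih]
    simp only [qInt, sum_range_succ, pow_mul]
    ring

@[simp] lemma qFact_zero (q : R) : qFact q 0 = 1 := by simp [qFact]

lemma qFact_succ (q : R) (n : ℕ) : qFact q (n + 1) = qFact q n * qInt q (n + 1) :=
  prod_range_succ _ _

variable {α : Type*} [LinearOrder α]

lemma sum_pow_mul_qInt (q : R) (k : α → ℕ) (s : Finset α) :
    ∑ i ∈ s, q ^ (∑ l ∈ s with i < l, k l) * qInt q (k i) = qInt q (∑ i ∈ s, k i) := by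
  induction s using Finset.induction_on_min with
  | empty => simp
  | insert a s ha ih =>
    have has : a ∉ s := fun h => lt_irrefl _ (ha a h)
    rw [sum_insert has, sum_insert has, add_comm (k a), qInt_add, ← ih, add_comm]
    congr 1
    · refine sum_congr rfl fun i hi => ?_
      rw [filter_insert, if_neg (ha i hi).not_gt]
    · rw [filter_insert, if_neg (lt_irrefl a), filter_true_of_mem ha]

/-- The number of occurrences of each letter in a word. -/
def letterCount {n : ℕ} (w : Fin n → α) (j : α) : ℕ := #{p | w p = j}

/-- The major index of a nonempty word over a linearly ordered alphabet. -/
def majIndex {n : ℕ} (w : Fin (n + 1) → α) : ℕ :=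
  ∑ r : Fin n, if w r.succ < w r.castSucc then (r : ℕ) + 1 else 0

lemma letterCount_snoc {n : ℕ} (w : Fin n → α) (x : α) :
    letterCount (Fin.snoc w x : Fin (n + 1) → α) = letterCount w + Pi.single x 1 := by
  ext j
  simp only [letterCount, card_filter, Fin.sum_univ_castSucc, Fin.snoc_castSucc, Fin.snoc_last,
    Pi.add_apply, Pi.single_apply, eq_comm]

lemma majIndex_snoc {n : ℕ} (w : Fin (n + 1) → α) (x : α) :
    majIndex (Fin.snoc w x : Fin (n + 2) → α) =
      majIndex w + if x < w (Fin.last n) then n + 1 else 0 := by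
  simp only [majIndex, Fin.sum_univ_castSucc (n := n), Fin.succ_castSucc, Fin.snoc_castSucc,
    Fin.succ_last, Fin.snoc_last, Fin.val_castSucc, Fin.val_last]

variable [Fintype α]

/-- The major index enumerator of the words with given letter counts and given last letter. -/
def majGenLast (q : R) (n : ℕ) (k : α → ℕ) (j : α) : R :=
  ∑ w : Fin (n + 1) → α, if letterCount w = k ∧ w (Fin.last n) = j then q ^ majIndex w else 0

/-- The major index enumerator of the words with given letter counts. -/
def majGen (q : R) (n : ℕ) (k : α → ℕ) : R :=
  ∑ w : Fin (n + 1) → α, if letterCount w = k then q ^ majIndex w else 0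

lemma majGen_eq_sum (q : R) (n : ℕ) (k : α → ℕ) :
    majGen q n k = ∑ j, majGenLast q n k j := by
  simp only [majGen, majGenLast]
  rw [sum_comm]
  refine sum_congr rfl fun w _ => ?_
  by_cases h : letterCount w = k <;> simp [h]

lemma majGenLast_succ (q : R) (n : ℕ) (k : α → ℕ) (j : α) :
    majGenLast q (n + 1) (k + Pi.single j 1) j =
      ∑ i, (if j < i then q ^ (n + 1) else 1) * majGenLast q n k i := by
  simp only [majGenLast, mul_sum]
  rw [sum_comm, ← (Fin.snocEquiv fun _ => α).sum_comp, Fintype.sum_prod_type,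
    Fintype.sum_eq_single j]
  · refine sum_congr rfl fun w _ => ?_
    rw [Fintype.sum_eq_single (w (Fin.last n)) fun i hi => by simp [hi.symm]]
    by_cases h : letterCount w = k
    · by_cases h' : j < w (Fin.last n) <;>
        simp [Fin.snocEquiv, letterCount_snoc, majIndex_snoc, h, h', pow_add, mul_comm]
    · simp [Fin.snocEquiv, letterCount_snoc, h]
  · intro x hx
    simp [Fin.snocEquiv, hx]

lemma majGenLast_eq_zero (q : R) (n : ℕ) (k : α → ℕ) (j : α) (hj : k j = 0) :
    majGenLast q n k j = 0 := by
  refine sum_eq_zero fun w _ => if_neg ?_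
  rintro ⟨rfl, hw⟩
  simp only [letterCount, card_eq_zero] at hj
  exact (Finset.eq_empty_iff_forall_notMem.1 hj (Fin.last n)) (by simp [hw])

lemma prod_qFact_add_single (q : R) (k : α → ℕ) (j : α) :
    ∏ i, qFact q ((k + Pi.single j 1 : α → ℕ) i) = (∏ i, qFact q (k i)) * qInt q (k j + 1) := by
  rw [← mul_prod_erase univ _ (mem_univ j), ← mul_prod_erase univ (fun i => qFact q (k i))
    (mem_univ j)]
  have : ∀ i ∈ univ.erase j, qFact q ((k + Pi.single j 1 : α → ℕ) i) = qFact q (k i) := by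
    intro i hi
    simp [ne_of_mem_erase hi]
  rw [prod_congr rfl this]
  simp [qFact_succ]
  ring

/-- The sum over `l > j` ignores changes of the `j`-th entry. -/
lemma sum_gt_add_single (k : α → ℕ) (j : α) :
    ∑ l with j < l, (k + Pi.single j 1 : α → ℕ) l = ∑ l with j < l, k l := by
  refine sum_congr rfl fun l hl => ?_
  simp [(mem_filter.1 hl).2.ne']

lemma majGenLast_mul_of_forall (q : R) (n : ℕ)
    (H : ∀ k : α → ℕ, ∑ i, k i = n → ∀ j, majGenLast q n (k + Pi.single j 1) j *
      ∏ i, qFact q (k i) = q ^ (∑ l with j < l, k l) * qFact q n)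
    (k : α → ℕ) (hk : ∑ i, k i = n + 1) (j : α) :
    majGenLast q n k j * ∏ i, qFact q (k i) =
      q ^ (∑ l with j < l, k l) * qInt q (k j) * qFact q n := by
  rcases Nat.eq_zero_or_pos (k j) with hj | hj
  · simp [hj, majGenLast_eq_zero]
  · obtain ⟨k', rfl⟩ : ∃ k' : α → ℕ, k = k' + Pi.single j 1 :=
      ⟨k - Pi.single j 1, (tsub_add_cancel_of_le (by
        intro i; by_cases h : i = j
        · subst h; simpa [Nat.one_le_iff_ne_zero, Nat.pos_iff_ne_zero] using hj
        · simp [h])).symm⟩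
    have hs : ∑ i, k' i = n := by
      simpa [sum_add_distrib] using hk
    rw [prod_qFact_add_single, ← mul_assoc, H k' hs, sum_gt_add_single]
    simp
    ring

/-- Enumeration by major index with a fixed last letter. -/
lemma majGenLast_mul (q : R) (n : ℕ) : ∀ k : α → ℕ, ∑ i, k i = n → ∀ j,
    majGenLast q n (k + Pi.single j 1) j * ∏ i, qFact q (k i) =
      q ^ (∑ l with j < l, k l) * qFact q n := by
  induction n with
  | zero =>
    intro k hk j
    obtain rfl : k = 0 := by ext i; simpa using (sum_eq_zero_iff.1 hk) i (mem_univ i)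
    rw [majGenLast, Fintype.sum_eq_single (fun _ => j)]
    · have : letterCount (fun _ : Fin 1 => j) = Pi.single j 1 := by
        ext i
        simp only [letterCount, card_filter, Fin.sum_univ_castSucc, univ_eq_empty, sum_empty,
          zero_add, Pi.single_apply, eq_comm]
      simp [this, majIndex]
    · intro w hw
      refine if_neg fun h => hw ?_
      ext i
      rw [Fin.fin_one_eq_zero i]; exact h.2
  | succ n ih =>
    intro k hk j
    rw [majGenLast_succ, sum_mul]
    have key : ∀ i, (if j < i then q ^ (n + 1) else 1) * majGenLast q n k i *
        ∏ i, qFact q (k i) = qFact q n * q ^ (∑ l with j < l, k l) *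
          if j < i then q ^ (∑ l with ¬ j < l, k l) *
            (q ^ (∑ l ∈ univ.filter (fun l => j < l) with i < l, k l) * qInt q (k i))
          else q ^ (∑ l ∈ univ.filter (fun l => ¬ j < l) with i < l, k l) * qInt q (k i) := by
      intro i
      rw [mul_assoc, majGenLast_mul_of_forall q n ih k hk i]
      split_ifs with h
      · have e : ∑ l ∈ univ.filter (fun l => j < l) with i < l, k l = ∑ l with i < l, k l := by
          rw [filter_filter]
          refine sum_congr (filter_congr fun l _ => ?_) fun _ _ => rfl
          exact ⟨fun h => h.2, fun h' => ⟨h.trans h', h'⟩⟩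
        have e' : n + 1 = ∑ l with j < l, k l + ∑ l with ¬ j < l, k l := by
          rw [sum_filter_add_sum_filter_not, hk]
        rw [e, e', pow_add]
        ring
      · have e : ∑ l with i < l, k l = ∑ l with j < l, k l +
            ∑ l ∈ univ.filter (fun l => ¬ j < l) with i < l, k l := by
          rw [← sum_filter_add_sum_filter_not (univ.filter fun l => i < l) (fun l => j < l)]
          congr 1
          · rw [filter_filter]
            refine sum_congr (filter_congr fun l _ => ?_) fun _ _ => rfl
            exact ⟨fun h => h.2, fun h' => ⟨(not_lt.1 h).trans_lt h', h'⟩⟩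
          · rw [filter_filter, filter_filter]
            refine sum_congr (filter_congr fun l _ => ?_) fun _ _ => rfl
            exact and_comm
        rw [e, pow_add]
        ring
    rw [sum_congr rfl fun i _ => key i, ← mul_sum, sum_ite, ← mul_sum, sum_pow_mul_qInt,
      sum_pow_mul_qInt, add_comm, ← qInt_add, add_comm (∑ l with ¬ j < l, k l),
      sum_filter_add_sum_filter_not, hk, qFact_succ]
    ring

/-- MacMahon's theorem: the major index is enumerated by the `q`-multinomial coefficient. -/
lemma majGen_mul (q : R) (n : ℕ) (k : α → ℕ) (hk : ∑ i, k i = n + 1) :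
    majGen q n k * ∏ i, qFact q (k i) = qFact q (n + 1) := by
  rw [majGen_eq_sum, sum_mul, sum_congr rfl fun j _ =>
    majGenLast_mul_of_forall q n (majGenLast_mul q n) k hk j, ← sum_mul, sum_pow_mul_qInt, hk,
    qFact_succ, mul_comm]

end QAnalogues

section RamanujanSum

lemma card_mul_sum_comp_of_surjective {G H K : Type*} [Group G] [Group H] [Fintype G] [Fintype H]
    [CommRing K] (φ : G →* H) (hφ : Function.Surjective φ) (f : H → K) :
    (Fintype.card H : K) * ∑ g, f (φ g) = Fintype.card G * ∑ h, f h := by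
  have h1 : ∀ h : H, ∑ g, f (φ g * h) = ∑ g, f (φ g) := by
    intro h
    obtain ⟨g', rfl⟩ := hφ h
    simpa using Equiv.sum_comp (Equiv.mulRight g') fun g => f (φ g)
  have h2 : ∀ g : G, ∑ h, f (φ g * h) = ∑ h, f h := fun g =>
    Equiv.sum_comp (Equiv.mulLeft (φ g)) f
  calc (Fintype.card H : K) * ∑ g, f (φ g) = ∑ h, ∑ g, f (φ g * h) := by simp [h1]
    _ = ∑ g, ∑ h, f (φ g * h) := sum_comm
    _ = _ := by simp [h2]

lemma sum_primitiveRoots_eq_sum_units {K M : Type*} [CommRing K] [IsDomain K] [AddCommMonoid M]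
    {d : ℕ} [NeZero d] {ζ : K} (hζ : IsPrimitiveRoot ζ d) (f : K → M) :
    ∑ x ∈ primitiveRoots d K, f x = ∑ u : (ZMod d)ˣ, f (ζ ^ (u : ZMod d).val) := by
  symm
  refine sum_bij (fun u _ => ζ ^ (u : ZMod d).val) ?_ ?_ ?_ fun _ _ => rfl
  · intro u _
    rw [mem_primitiveRoots (NeZero.pos d)]
    exact hζ.pow_of_coprime _ (ZMod.val_coe_unit_coprime u)
  · intro u _ v _ h
    exact Units.ext (ZMod.val_injective d
      (hζ.pow_inj (ZMod.val_lt _) (ZMod.val_lt _) h))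
  · intro x hx
    rw [mem_primitiveRoots (NeZero.pos d), hζ.isPrimitiveRoot_iff] at hx
    obtain ⟨i, hi, hc, rfl⟩ := hx
    exact ⟨ZMod.unitOfCoprime i hc, mem_univ _, by simp [ZMod.val_natCast_of_lt hi]⟩

lemma sum_nthRootsFinset_eq {M : Type*} [AddCommMonoid M] (n : ℕ) (f : ℂ → M) :
    ∑ x ∈ nthRootsFinset n (1 : ℂ), f x = ∑ d ∈ n.divisors, ∑ x ∈ primitiveRoots d ℂ, f x := by
  rw [IsPrimitiveRoot.nthRoots_one_eq_biUnion_primitiveRoots, sum_biUnion]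
  intro a _ b _ hab
  exact IsPrimitiveRoot.disjoint hab

lemma sum_nthRootsFinset_pow {m : ℕ} (hm : m ≠ 0) (a : ℕ) :
    ∑ x ∈ nthRootsFinset m (1 : ℂ), x ^ a = if m ∣ a then (m : ℂ) else 0 := by
  have hζ := Complex.isPrimitiveRoot_exp m hm
  split_ifs with h
  · obtain ⟨b, rfl⟩ := h
    have : ∀ x ∈ nthRootsFinset m (1 : ℂ), x ^ (m * b) = 1 := by
      intro x hx
      rw [pow_mul, (mem_nthRootsFinset (Nat.pos_of_ne_zero hm) _).1 hx, one_pow]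
    rw [sum_congr rfl this]
    simp [hζ.card_nthRootsFinset]
  · set ζ := Complex.exp (2 * Real.pi * Complex.I / m)
    have hs : ζ ^ a * ∑ x ∈ nthRootsFinset m (1 : ℂ), x ^ a =
        ∑ x ∈ nthRootsFinset m (1 : ℂ), x ^ a := by
      rw [mul_sum]
      have hm' := Nat.pos_of_ne_zero hm
      refine sum_bij (fun x _ => ζ * x) ?_ ?_ ?_ ?_
      · intro x hx
        rw [mem_nthRootsFinset hm'] at hx ⊢
        rw [mul_pow, hx, hζ.pow_eq_one, one_mul]
      · intro x _ y _ h
        exact mul_left_cancel₀ (hζ.ne_zero hm) h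
      · intro y hy
        refine ⟨ζ⁻¹ * y, ?_, mul_inv_cancel_left₀ (hζ.ne_zero hm) y⟩
        rw [mem_nthRootsFinset hm'] at hy ⊢
        rw [mul_pow, hy, inv_pow, hζ.pow_eq_one, inv_one, one_mul]
      · intro x _
        rw [mul_pow]
    have h1 : ζ ^ a - 1 ≠ 0 := sub_ne_zero.2 fun h' => h ((hζ.pow_eq_one_iff_dvd a).1 h')
    refine (mul_eq_zero.1 ?_).resolve_left h1
    rw [sub_mul, hs, one_mul, sub_self]

lemma sum_primitiveRoots_id (n : ℕ) (hn : 0 < n) :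
    ∑ x ∈ primitiveRoots n ℂ, x = ArithmeticFunction.moebius n := by
  have h := (ArithmeticFunction.sum_eq_iff_sum_mul_moebius_eq
    (f := fun d => ∑ x ∈ primitiveRoots d ℂ, x)
    (g := fun d => if d = 1 then (1 : ℂ) else 0)).1 (by
      intro n hn
      rw [← sum_nthRootsFinset_eq]
      have := sum_nthRootsFinset_pow hn.ne' 1
      simp only [pow_one, Nat.dvd_one] at this
      rw [this]
      split_ifs with h <;> simp [h]) n hn
  rw [← h, sum_eq_single (n, 1)]
  · simp
  · rintro ⟨a, b⟩ hab hne
    have hab := (Nat.mem_divisorsAntidiagonal.1 hab).1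
    have : b ≠ 1 := by rintro rfl; simp at hab; simp [hab] at hne
    simp [this]
  · intro h
    exact absurd (Nat.mem_divisorsAntidiagonal.2 ⟨mul_one n, hn.ne'⟩) h

/-- Hölder's evaluation of the Ramanujan sum. -/
lemma sum_primitiveRoots_pow {d : ℕ} (hd : 0 < d) (n : ℕ) :
    ∑ x ∈ primitiveRoots d ℂ, x ^ n =
      Nat.totient d * (ArithmeticFunction.moebius (d / d.gcd n) : ℂ) /
        Nat.totient (d / d.gcd n) := by
  have hg : 0 < d.gcd n := Nat.gcd_pos_of_pos_left n hd
  obtain ⟨e, he⟩ : d.gcd n ∣ d := Nat.gcd_dvd_left d n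
  have hde : d / d.gcd n = e := Nat.div_eq_of_eq_mul_right hg he
  have hed : e ∣ d := ⟨_, by rw [mul_comm]; exact he⟩
  have he0 : 0 < e := Nat.pos_of_dvd_of_pos hed hd
  have : NeZero d := ⟨hd.ne'⟩
  have : NeZero e := ⟨he0.ne'⟩
  have hζ := Complex.isPrimitiveRoot_exp d hd.ne'
  set ζ := Complex.exp (2 * Real.pi * Complex.I / d)
  have hy : IsPrimitiveRoot (ζ ^ n) e := by
    have := IsPrimitiveRoot.orderOf (ζ ^ n)
    rwa [(hζ.isOfFinOrder hd.ne').orderOf_pow, ← hζ.eq_orderOf, hde] at this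
  rw [hde, eq_div_iff (by simpa using he0.ne'), mul_comm, sum_primitiveRoots_eq_sum_units hζ,
    ← sum_primitiveRoots_id e he0, sum_primitiveRoots_eq_sum_units hy (fun x => x)]
  have := card_mul_sum_comp_of_surjective (ZMod.unitsMap hed) (ZMod.unitsMap_surjective hed)
    (fun v => (ζ ^ n) ^ (v : ZMod e).val)
  simp only [ZMod.card_units_eq_totient] at this
  rw [← this]
  congr 1
  refine sum_congr rfl fun u _ => ?_
  rw [← pow_mul, mul_comm, pow_mul, ZMod.unitsMap_val, ZMod.cast_eq_val, ZMod.val_natCast]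
  exact pow_eq_pow_mod _ hy.pow_eq_one

end RamanujanSum

section RootsOfUnity

/-- The cofactor of `[d]_q ^ (n / d)` in `[n]_q!`. -/
noncomputable def qFactRest (d n : ℕ) : ℂ[X] :=
  ∏ i ∈ range n, if d ∣ i + 1 then qInt (X ^ d) ((i + 1) / d) else qInt X (i + 1)

lemma qFact_X_eq (d n : ℕ) : qFact (X : ℂ[X]) n = qInt X d ^ (n / d) * qFactRest d n := by
  induction n with
  | zero => simp [qFactRest]
  | succ n ih =>
    rw [qFact_succ, ih, qFactRest, qFactRest, prod_range_succ, Nat.succ_div]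
    split_ifs with h
    · obtain ⟨b, hb⟩ := h
      rcases Nat.eq_zero_or_pos d with rfl | hd
      · simp at hb
      · have hnb : n / d + 1 = b := by
          rw [← Nat.mul_div_cancel_left b hd, ← hb, Nat.succ_div, if_pos ⟨b, hb⟩]
        rw [hb, qInt_mul, ← hnb]
        ring
    · ring

lemma eval_qInt (z : ℂ) (p : ℂ[X]) (n : ℕ) : eval z (qInt p n) = qInt (eval z p) n := by
  simp [qInt, eval_finsetSum]

lemma eval_majGen {α : Type*} [LinearOrder α] [Fintype α] (z : ℂ) (n : ℕ) (k : α → ℕ) :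
    eval z (majGen X n k) = majGen z n k := by
  simp only [majGen, eval_finsetSum]
  refine sum_congr rfl fun w _ => ?_
  split_ifs <;> simp

variable {d : ℕ} {ζ : ℂ}

lemma qInt_ne_zero (hζ : IsPrimitiveRoot ζ d) {n : ℕ} (h : ¬ d ∣ n) : qInt ζ n ≠ 0 := by
  intro h0
  have := geom_sum_mul ζ n
  rw [← qInt, h0, zero_mul] at this
  exact h ((hζ.pow_eq_one_iff_dvd n).1 (sub_eq_zero.1 this.symm))

lemma qInt_add_mul (hζ : IsPrimitiveRoot ζ d) (hd : 1 < d) (a n : ℕ) :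
    qInt ζ (d * a + n) = qInt ζ n := by
  have h0 : qInt ζ d = 0 := hζ.geom_sum_eq_zero hd
  rw [qInt_add, qInt_mul, h0, pow_mul, hζ.pow_eq_one]
  simp

lemma eval_qFactRest (hζ : IsPrimitiveRoot ζ d) (n : ℕ) :
    eval ζ (qFactRest d n) =
      ∏ i ∈ range n, if d ∣ i + 1 then (((i + 1) / d : ℕ) : ℂ) else qInt ζ (i + 1) := by
  rw [qFactRest, eval_prod]
  refine prod_congr rfl fun i _ => ?_
  split_ifs <;> simp [eval_qInt, hζ.pow_eq_one, qInt_one_left]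

lemma eval_qFactRest_ne_zero (hζ : IsPrimitiveRoot ζ d) (hd : 0 < d) (n : ℕ) :
    eval ζ (qFactRest d n) ≠ 0 := by
  rw [eval_qFactRest hζ, prod_ne_zero_iff]
  intro i _
  split_ifs with h
  · exact Nat.cast_ne_zero.2 (Nat.div_pos (Nat.le_of_dvd i.succ_pos h) hd).ne'
  · exact qInt_ne_zero hζ h

lemma eval_qFactRest_mul (hζ : IsPrimitiveRoot ζ d) (hd : 0 < d) (a : ℕ) :
    eval ζ (qFactRest d (d * a)) =
      (∏ i ∈ range (d - 1), qInt ζ (i + 1)) ^ a * (a.factorial : ℂ) := by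
  rw [eval_qFactRest hζ]
  induction a with
  | zero => simp
  | succ a ih =>
    have hlast : d * a + (d - 1) + 1 = d * (a + 1) := by
      rw [mul_add, mul_one, add_assoc, Nat.sub_add_cancel hd]
    rw [← hlast, prod_range_succ, prod_range_add, ih, hlast, if_pos (dvd_mul_right _ _),
      Nat.mul_div_cancel_left _ hd]
    have : ∀ i ∈ range (d - 1), (if d ∣ d * a + i + 1 then (((d * a + i + 1) / d : ℕ) : ℂ)
        else qInt ζ (d * a + i + 1)) = qInt ζ (i + 1) := by
      intro i hi
      have hi := mem_range.1 hi
      rw [if_neg, add_assoc, qInt_add_mul hζ (by omega)]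
      rw [add_assoc, Nat.dvd_add_right (dvd_mul_right d a)]
      exact fun h => absurd (Nat.le_of_dvd i.succ_pos h) (by omega)
    rw [prod_congr rfl this, Nat.factorial_succ]
    push_cast
    ring

lemma majGen_mul_eval {α : Type*} [LinearOrder α] [Fintype α] (ζ : ℂ)
    (hd : 0 < d) (n : ℕ) (k : α → ℕ) (hk : ∑ i, k i = n + 1) :
    majGen ζ n k * ∏ j, eval ζ (qFactRest d (k j)) =
      qInt ζ d ^ ((n + 1) / d - ∑ j, k j / d) * eval ζ (qFactRest d (n + 1)) := by
  have hle : ∑ j, k j / d ≤ (n + 1) / d := by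
    rw [Nat.le_div_iff_mul_le hd, ← hk, sum_mul]
    exact sum_le_sum fun j _ => Nat.div_mul_le_self _ _
  have h0 : qInt (X : ℂ[X]) d ≠ 0 := by
    intro h
    have := congrArg (eval 1) h
    rw [eval_qInt, eval_X, qInt_one_left, eval_zero] at this
    exact hd.ne' (by exact_mod_cast this)
  have h := majGen_mul (X : ℂ[X]) n k hk
  simp only [qFact_X_eq d, prod_mul_distrib, prod_pow_eq_pow_sum] at h
  rw [← Nat.add_sub_cancel' hle, pow_add, mul_left_comm, mul_assoc,
    mul_right_inj' (pow_ne_zero _ h0)] at h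
  have := congrArg (eval ζ) h
  simpa [eval_prod, eval_majGen, eval_qInt] using this

/-- The major index enumerator of the words with given letter counts at a root of unity. -/
lemma majGen_of_isPrimitiveRoot {α : Type*} [LinearOrder α] [Fintype α]
    (hζ : IsPrimitiveRoot ζ d) (hd : 0 < d) (n : ℕ) (hdn : d ∣ n + 1) (k : α → ℕ)
    (hk : ∑ i, k i = n + 1) :
    majGen ζ n k = if ∀ j, d ∣ k j then
      (((n + 1) / d).factorial : ℂ) / ∏ j, ((k j / d).factorial : ℂ) else 0 := by
  have h := majGen_mul_eval ζ hd n k hk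
  split_ifs with hdk
  · have hs : ∑ j, k j / d = (n + 1) / d := by
      refine (Nat.div_eq_of_eq_mul_left hd ?_).symm
      rw [← hk, sum_mul]
      exact sum_congr rfl fun j _ => (Nat.div_mul_cancel (hdk j)).symm
    have hC : ∏ i ∈ range (d - 1), qInt ζ (i + 1) ≠ 0 := prod_ne_zero_iff.2 fun i hi =>
      qInt_ne_zero hζ fun h => absurd (Nat.le_of_dvd i.succ_pos h)
        (by have := mem_range.1 hi; omega)
    have hrest : ∀ a, d ∣ a → eval ζ (qFactRest d a) =
        (∏ i ∈ range (d - 1), qInt ζ (i + 1)) ^ (a / d) * ((a / d).factorial : ℂ) := by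
      rintro _ ⟨b, rfl⟩
      rw [eval_qFactRest_mul hζ hd, Nat.mul_div_cancel_left b hd]
    rw [prod_congr rfl fun j _ => hrest (k j) (hdk j), hrest _ hdn, prod_mul_distrib,
      prod_pow_eq_pow_sum, hs, Nat.sub_self, pow_zero, one_mul, mul_left_comm,
      mul_right_inj' (pow_ne_zero _ hC)] at h
    rw [eq_div_iff (prod_ne_zero_iff.2 fun j _ => Nat.cast_ne_zero.2 (Nat.factorial_ne_zero _)),
      h]
  · have hlt : ∑ j, k j / d < (n + 1) / d := by
      rw [Nat.lt_div_iff_mul_lt' hdn, ← hk, mul_comm, sum_mul]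
      push Not at hdk
      obtain ⟨j, hj⟩ := hdk
      refine sum_lt_sum (fun j _ => Nat.div_mul_le_self _ _) ⟨j, mem_univ j, ?_⟩
      exact lt_of_le_of_ne (Nat.div_mul_le_self _ _) fun h => hj ⟨_, by rw [mul_comm]; exact h.symm⟩
    have h1 : 1 < d := by
      by_contra h1
      obtain rfl : d = 1 := by omega
      exact hdk fun j => one_dvd _
    have h0 : qInt ζ d = 0 := hζ.geom_sum_eq_zero h1
    rw [h0, zero_pow (Nat.sub_pos_of_lt hlt).ne', zero_mul] at h
    exact (mul_eq_zero.1 h).resolve_right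
      (prod_ne_zero_iff.2 fun j _ => eval_qFactRest_ne_zero hζ hd _)

/-- The number of words with given letter counts and given residue of the major index. -/
lemma mul_card_majIndex {α : Type*} [LinearOrder α] [Fintype α] (m : ℕ) (k : α → ℕ)
    (hk : ∑ i, k i = m + 1) (n : ℕ) :
    ((m + 1 : ℕ) : ℂ) *
        (#{w : Fin (m + 1) → α | letterCount w = k ∧ m + 1 ∣ majIndex w + n} : ℂ) =
      ∑ d ∈ (univ.gcd k).divisors,
        Nat.totient d * (ArithmeticFunction.moebius (d / d.gcd n) : ℂ) /
          Nat.totient (d / d.gcd n) *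
            ((((m + 1) / d).factorial : ℂ) / ∏ j, ((k j / d).factorial : ℂ)) := by
  have hdiv : (univ.gcd k).divisors = (m + 1).divisors.filter fun d => ∀ j, d ∣ k j := by
    ext d
    have hg : univ.gcd k ≠ 0 := by
      intro h
      rw [Finset.gcd_eq_zero_iff] at h
      rw [sum_eq_zero fun i hi => h i hi] at hk
      omega
    simp only [Nat.mem_divisors, mem_filter, Finset.dvd_gcd_iff, mem_univ, true_imp_iff]
    refine ⟨fun h => ⟨⟨?_, m.succ_ne_zero⟩, h.1⟩, fun h => ⟨h.2, hg⟩⟩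
    rw [← hk]
    exact dvd_sum fun i _ => h.1 i
  calc ((m + 1 : ℕ) : ℂ) *
        (#{w : Fin (m + 1) → α | letterCount w = k ∧ m + 1 ∣ majIndex w + n} : ℂ)
      = ∑ w : Fin (m + 1) → α, if letterCount w = k then
          ∑ x ∈ nthRootsFinset (m + 1) (1 : ℂ), x ^ (majIndex w + n) else 0 := by
        rw [card_filter, Nat.cast_sum, mul_sum]
        refine sum_congr rfl fun w _ => ?_
        rw [sum_nthRootsFinset_pow m.succ_ne_zero]
        by_cases h : letterCount w = k <;> simp [h]
    _ = ∑ x ∈ nthRootsFinset (m + 1) (1 : ℂ), x ^ n * majGen x m k := by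
        simp only [majGen, mul_sum]
        rw [sum_comm]
        refine sum_congr rfl fun w _ => ?_
        split_ifs <;> simp [pow_add, mul_comm]
    _ = ∑ d ∈ (m + 1).divisors, if ∀ j, d ∣ k j then
          (∑ x ∈ primitiveRoots d ℂ, x ^ n) *
            ((((m + 1) / d).factorial : ℂ) / ∏ j, ((k j / d).factorial : ℂ)) else 0 := by
        rw [sum_nthRootsFinset_eq]
        refine sum_congr rfl fun d hd => ?_
        have hd' : 0 < d := Nat.pos_of_mem_divisors hd
        rw [← mul_ite_zero, sum_mul]
        refine sum_congr rfl fun x hx => ?_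
        rw [majGen_of_isPrimitiveRoot ((mem_primitiveRoots hd').1 hx) hd' m
          (Nat.dvd_of_mem_divisors hd) k hk]
    _ = _ := by
        rw [hdiv, sum_filter]
        refine sum_congr rfl fun d hd => ?_
        rw [sum_primitiveRoots_pow (Nat.pos_of_mem_divisors hd)]

end RootsOfUnity

section Words

variable {ℓ m : ℕ}

lemma Nfun_add_MajFun (w : Fin m → ZMod (ℓ + 1)) :
    Nfun w + MajFun w = m * (1 + #(desc w)) := by
  have h1 : ∑ p : Fin m, #((desc w).filter fun r => r < p) =
      ∑ r ∈ desc w, (m - 1 - (r : ℕ)) := by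
    simp only [card_filter]
    rw [sum_comm]
    refine sum_congr rfl fun r _ => ?_
    rw [← card_filter, ← Fin.card_Ioi]
    congr 1
    ext p
    simp
  have h2 : ∑ r ∈ desc w, (m - 1 - (r : ℕ)) + ∑ r ∈ desc w, ((r : ℕ) + 1) = #(desc w) * m := by
    rw [← sum_add_distrib, ← smul_eq_mul, ← sum_const]
    exact sum_congr rfl fun r _ => by omega
  rw [Nfun, MajFun, sum_add_distrib, h1, add_assoc, h2]
  simp
  ring

lemma Nfun_modEq_iff (w : Fin m → ZMod (ℓ + 1)) (n : ℕ) :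
    Nfun w ≡ n [MOD m] ↔ m ∣ MajFun w + n := by
  have h : m ∣ Nfun w + MajFun w := ⟨_, Nfun_add_MajFun w⟩
  rw [← Nat.modEq_zero_iff_dvd] at h ⊢
  rw [add_comm (MajFun w)]
  exact ⟨fun h' => (h'.symm.add_right _).trans h,
    fun h' => Nat.ModEq.add_right_cancel' _ (h.trans h'.symm)⟩

/-- Residues modulo `ℓ + 1` ordered by their least nonnegative representatives. -/
abbrev valLinearOrder (ℓ : ℕ) : LinearOrder (ZMod (ℓ + 1)) :=
  LinearOrder.lift' ZMod.val (ZMod.val_injective (ℓ + 1))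

attribute [local instance] valLinearOrder

lemma MajFun_eq_majIndex (w : Fin (m + 1) → ZMod (ℓ + 1)) : MajFun w = majIndex w := by
  rw [MajFun, desc, sum_filter, Fin.sum_univ_castSucc, majIndex, if_neg (by simp), add_zero]
  refine sum_congr rfl fun r _ => ?_
  refine if_congr ?_ (by simp) rfl
  simp only [Fin.val_castSucc, Nat.add_lt_add_iff_right, r.isLt, exists_true_left]
  rfl

lemma content_eq_letterCount (w : Fin m → ZMod (ℓ + 1)) : content w = letterCount w := by
  ext j
  rw [content, letterCount]
  congr

lemma ncard_eq_card_majIndex (k : ZMod (ℓ + 1) → ℕ) (n : ℕ) :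
    {w : Fin (m + 1) → ZMod (ℓ + 1) |
        (∀ j, content w j = k j) ∧ Nfun w ≡ n [MOD m + 1]}.ncard =
      #{w : Fin (m + 1) → ZMod (ℓ + 1) | letterCount w = k ∧ m + 1 ∣ majIndex w + n} := by
  rw [← Set.ncard_coe_finset]
  congr 1
  ext w
  simp [Nfun_modEq_iff, MajFun_eq_majIndex, ← content_eq_letterCount, funext_iff]

end Words

/-- for a content `(k_0,…,k_ℓ)` with `k_0 + ⋯ + k_ℓ = m` and
`0 ≤ n < m`, the number of words `w` of length `m` with content `(k_j)` and
`N(w) ≡ n (mod m)` equals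
`(1/m) Σ_{d ∣ gcd(k_0,…,k_ℓ)} φ_{−n}(d) · (m/d)!/((k_0/d)!⋯(k_ℓ/d)!)`. -/
theorem stmt_2 (ℓ m : ℕ) (hℓ : 1 ≤ ℓ) (hm : 1 ≤ m)
    (k : ZMod (ℓ + 1) → ℕ) (hk : ∑ j, k j = m)
    (n : ℕ) (hn : n < m) :
    ({w : Fin m → ZMod (ℓ + 1) |
        (∀ j, content w j = k j) ∧ Nfun w ≡ n [MOD m]}.ncard : ℚ)
      = (1 / (m : ℚ)) * ∑ d ∈ (univ.gcd k).divisors,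
          phiInt (-(n : ℤ)) d *
            (((m / d).factorial : ℚ) / ∏ j, ((k j / d).factorial : ℚ)) := by
  obtain ⟨m, rfl⟩ := Nat.exists_eq_add_of_le' hm
  let := valLinearOrder ℓ
  rw [ncard_eq_card_majIndex, one_div, eq_inv_mul_iff_mul_eq₀ (Nat.cast_ne_zero.2 m.succ_ne_zero)]
  have h := mul_card_majIndex m k hk n
  apply (Rat.cast_injective (α := ℂ))
  push_cast [phiInt, Int.natAbs_neg, Int.natAbs_natCast] at h ⊢
  exact h

end GreensteinPaths
end
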